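/- Let D be a Γ-invariant linear operator on compactly supported sections of finite propagation speed and (Γ_j) a tower in Γ. Then tr e^{zD_{Γ_j}}/[Γ:Γ_j] converges to tr_Γ e^{zD} as j → ∞, uniformly for z in the closed unit disc of ℂ. -/

import Mathlib

open scoped BigOperators
open Filter

noncomputable section

variable {Y Γ V : Type*}

section Defs

variable [Group Γ] [MulAction Γ Y]
variable [NormedAddCommGroup V] [InnerProductSpace ℂ V]

/-- The action of `γ ∈ Γ` on compactly (= finitely) supported sections
`φ : Y →₀ V`, given by `(γ · φ)(y) = ρ(γ) φ(γ⁻¹ • y)`. -/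
def secAct (ρ : Γ →* (V ≃ₗᵢ[ℂ] V)) (γ : Γ) (φ : Y →₀ V) : Y →₀ V :=
  Finsupp.equivMapDomain (MulAction.toPerm γ) (φ.mapRange (ρ γ) ((ρ γ).map_zero))

/-- A linear operator on compactly supported sections is `Γ`-invariant if it
commutes with the action of `Γ`. -/
def IsEquivariantOp (ρ : Γ →* (V ≃ₗᵢ[ℂ] V)) (D : (Y →₀ V) →ₗ[ℂ] (Y →₀ V)) : Prop :=
  ∀ (γ : Γ) (φ : Y →₀ V), D (secAct ρ γ φ) = secAct ρ γ (D φ)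

/-- The kernel `⟨x|D|y⟩ ∈ End(V)` of an operator `D`, characterized by
`⟨x|D|y⟩ v = (D δ_{y,v})(x)`. -/
def kernelOf (D : (Y →₀ V) →ₗ[ℂ] (Y →₀ V)) (x y : Y) : V →ₗ[ℂ] V :=
  (Finsupp.lapply x) ∘ₗ D ∘ₗ (Finsupp.lsingle y)

/-- `D` has finite propagation speed `≤ R`:
`supp (Dφ) ⊆ U_R(supp φ) = {x | ∃ y ∈ supp φ, d(x,y) ≤ R}`. -/
def HasPropSpeed [MetricSpace Y] (D : (Y →₀ V) →ₗ[ℂ] (Y →₀ V)) (R : ℝ) : Prop :=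
  ∀ (φ : Y →₀ V) (x : Y), D φ x ≠ 0 → ∃ y ∈ φ.support, dist x y ≤ R

/-- A set of representatives of the orbits of a group `G` acting on `Y`:
it contains exactly one point of every orbit. -/
def IsRepSet (G : Type*) [Group G] [MulAction G Y] (S : Set Y) : Prop :=
  ∀ y : Y, ∃! s, s ∈ S ∧ s ∈ MulAction.orbit G y

/-- The space `W_{Γ'}` of `Γ'`-equivariant functions `f : Y → V`,
i.e. `f(γ • y) = ρ(γ) f(y)` for all `γ ∈ Γ'`. -/
def equivSubmodule (ρ : Γ →* (V ≃ₗᵢ[ℂ] V)) (Γ' : Subgroup Γ) : Submodule ℂ (Y → V) where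
  carrier := {f | ∀ (γ : Γ') (y : Y), f ((γ : Γ) • y) = ρ (γ : Γ) (f y)}
  add_mem' := by intro f g hf hg γ y; simp only [Pi.add_apply, hf γ y, hg γ y, map_add]
  zero_mem' := by intro γ y; simp
  smul_mem' := by intro c f hf γ y; simp only [Pi.smul_apply, hf γ y, map_smul]

/-- The summation map `S_{Γ'} φ (y) = Σ_{γ ∈ Γ'} ρ(γ)⁻¹ φ(γ • y)`. -/
def smap (ρ : Γ →* (V ≃ₗᵢ[ℂ] V)) (Γ' : Subgroup Γ) (φ : Y →₀ V) : Y → V :=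
  fun y => ∑ᶠ γ : Γ', ρ ((γ : Γ)⁻¹) (φ ((γ : Γ) • y))

/-- `DG` is the pushdown of `D` to `W_{Γ'}`, i.e. `DG ∘ S_{Γ'} = S_{Γ'} ∘ D`. -/
def IsPushdown (ρ : Γ →* (V ≃ₗᵢ[ℂ] V)) (Γ' : Subgroup Γ)
    (D : (Y →₀ V) →ₗ[ℂ] (Y →₀ V))
    (DG : equivSubmodule (Y := Y) ρ Γ' →ₗ[ℂ] equivSubmodule (Y := Y) ρ Γ') : Prop :=
  ∀ (w : equivSubmodule (Y := Y) ρ Γ') (φ : Y →₀ V),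
    (w : Y → V) = smap ρ Γ' φ → ((DG w : Y → V) = smap ρ Γ' (D φ))

/-- The kernel `⟨x|D|y⟩`, as a continuous linear map on `V`. -/
def kernelOfL [FiniteDimensional ℂ V] (D : (Y →₀ V) →ₗ[ℂ] (Y →₀ V)) (x y : Y) : V →L[ℂ] V :=
  LinearMap.toContinuousLinearMap (kernelOf D x y)

/-- The heat kernel `⟨x|e^{zD}|y⟩ = Σ_{n ≥ 0} (zⁿ/n!) ⟨x|Dⁿ|y⟩`. -/
def heatKer [FiniteDimensional ℂ V] (D : (Y →₀ V) →ₗ[ℂ] (Y →₀ V)) (z : ℂ) (x y : Y) :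
    V →L[ℂ] V :=
  ∑' n : ℕ, (z ^ n / (n.factorial : ℂ)) • kernelOfL (D ^ n) x y

/-- The `Γ`-trace `tr_Γ e^{zD} = Σ_{s ∈ S} tr ⟨s|e^{zD}|s⟩`,
for a set `S` of representatives of the `Γ`-orbits. -/
def trGammaHeat [FiniteDimensional ℂ V] (D : (Y →₀ V) →ₗ[ℂ] (Y →₀ V)) (z : ℂ)
    (S : Set Y) : ℂ :=
  ∑ᶠ s ∈ S, LinearMap.trace ℂ V ((heatKer D z s s : V →L[ℂ] V) : V →ₗ[ℂ] V)

/-- `tr e^{zT}` for an endomorphism `T` of a finite dimensional space,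
via the exponential series `Σ_{n ≥ 0} (zⁿ/n!) tr(Tⁿ)`. -/
def trExp {W : Type*} [AddCommGroup W] [Module ℂ W] (T : W →ₗ[ℂ] W) (z : ℂ) : ℂ :=
  ∑' n : ℕ, z ^ n / (n.factorial : ℂ) * LinearMap.trace ℂ W (T ^ n)

end Defs

section Analysis

/-- Exponential generating series of sequences with a common geometric bound converge uniformly
on the closed unit disc as soon as their coefficients converge. -/
theorem tendstoUniformlyOn_expSeries (a : ℕ → ℕ → ℂ) (b : ℕ → ℂ) (B C : ℝ)
    (ha : ∀ j n, ‖a j n‖ ≤ B * C ^ n)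
    (hab : ∀ n, Tendsto (fun j => a j n) atTop (nhds (b n))) :
    TendstoUniformlyOn (fun (j : ℕ) (z : ℂ) => ∑' n : ℕ, z ^ n / (n.factorial : ℂ) * a j n)
      (fun z => ∑' n : ℕ, z ^ n / (n.factorial : ℂ) * b n) atTop (Metric.closedBall 0 1) := by
  have hb : ∀ n, ‖b n‖ ≤ B * C ^ n := fun n =>
    le_of_tendsto (hab n).norm (Eventually.of_forall fun j => ha j n)
  have hsum : Summable fun n : ℕ => (n.factorial : ℝ)⁻¹ * (B * C ^ n) := by
    refine ((Real.summable_pow_div_factorial C).mul_left B).congr fun n => ?_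
    ring
  have hfac : ∀ (z : ℂ), z ∈ Metric.closedBall (0 : ℂ) 1 → ∀ (c : ℂ) (n : ℕ),
      ‖z ^ n / (n.factorial : ℂ) * c‖ ≤ (n.factorial : ℝ)⁻¹ * ‖c‖ := by
    intro z hz c n
    rw [mem_closedBall_zero_iff] at hz
    rw [norm_mul, norm_div, norm_pow, Complex.norm_natCast, div_eq_inv_mul]
    gcongr
    exact mul_le_of_le_one_right (by positivity) (pow_le_one₀ (norm_nonneg z) hz)
  have hsummable : ∀ (z : ℂ), z ∈ Metric.closedBall (0 : ℂ) 1 → ∀ c : ℕ → ℂ,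
      (∀ n, ‖c n‖ ≤ B * C ^ n) → Summable fun n : ℕ => z ^ n / (n.factorial : ℂ) * c n := by
    intro z hz c hc
    refine Summable.of_norm_bounded hsum fun n => (hfac z hz _ n).trans ?_
    gcongr
    exact hc n
  have hdiff : ∀ j n, ‖b n - a j n‖ ≤ 2 * (B * C ^ n) := fun j n =>
    (norm_sub_le _ _).trans (by linarith [ha j n, hb n])
  have hlim : Tendsto (fun j => ∑' n : ℕ, (n.factorial : ℝ)⁻¹ * ‖b n - a j n‖) atTop
      (nhds (∑' _ : ℕ, 0)) := by
    refine tendsto_tsum_of_dominated_convergence (hsum.mul_left 2) (fun n => ?_)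
      (Eventually.of_forall fun j n => ?_)
    · simpa using (((tendsto_const_nhds (x := b n)).sub (hab n)).norm.const_mul
        ((n.factorial : ℝ)⁻¹))
    · rw [Real.norm_of_nonneg (by positivity), mul_left_comm]
      gcongr
      exact hdiff j n
  rw [tsum_zero] at hlim
  rw [Metric.tendstoUniformlyOn_iff]
  intro ε hε
  filter_upwards [hlim.eventually_lt_const hε] with j hj z hz
  refine lt_of_le_of_lt ?_ hj
  rw [dist_eq_norm, ← (hsummable z hz b hb).tsum_sub (hsummable z hz (a j) (ha j))]
  refine tsum_of_norm_bounded (Summable.hasSum ?_) fun n => ?_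
  · refine Summable.of_nonneg_of_le (fun n => by positivity) (fun n => ?_) (hsum.mul_left 2)
    rw [mul_left_comm]
    gcongr
    exact hdiff j n
  · rw [← mul_sub]
    exact hfac z hz _ n

end Analysis

section OneNorm

variable [NormedAddCommGroup V]

/-- The `ℓ¹`-norm of a finitely supported section. -/
def oneNorm (φ : Y →₀ V) : ℝ := φ.sum fun _ v => ‖v‖

theorem oneNorm_eq_sum {φ : Y →₀ V} {t : Finset Y} (h : φ.support ⊆ t) :
    oneNorm φ = ∑ y ∈ t, ‖φ y‖ :=
  Finsupp.sum_of_support_subset _ h _ fun _ _ => norm_zero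

theorem sum_norm_le_oneNorm (φ : Y →₀ V) (t : Finset Y) : ∑ y ∈ t, ‖φ y‖ ≤ oneNorm φ := by
  classical
  rw [oneNorm_eq_sum (Finset.subset_union_left (s₂ := t))]
  exact Finset.sum_le_sum_of_subset_of_nonneg Finset.subset_union_right
    fun _ _ _ => norm_nonneg _

theorem norm_apply_le_oneNorm (φ : Y →₀ V) (y : Y) : ‖φ y‖ ≤ oneNorm φ := by
  simpa using sum_norm_le_oneNorm φ {y}

theorem oneNorm_nonneg (φ : Y →₀ V) : 0 ≤ oneNorm φ :=
  Finset.sum_nonneg fun _ _ => norm_nonneg _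

@[simp]
theorem oneNorm_zero : oneNorm (0 : Y →₀ V) = 0 := Finsupp.sum_zero_index

@[simp]
theorem oneNorm_single (y : Y) (v : V) : oneNorm (Finsupp.single y v) = ‖v‖ :=
  Finsupp.sum_single_index norm_zero

theorem oneNorm_add_le (φ ψ : Y →₀ V) : oneNorm (φ + ψ) ≤ oneNorm φ + oneNorm ψ := by
  classical
  rw [oneNorm_eq_sum (Finsupp.support_add (g₁ := φ) (g₂ := ψ)),
    oneNorm_eq_sum (Finset.subset_union_left (s₁ := φ.support) (s₂ := ψ.support)),
    oneNorm_eq_sum (Finset.subset_union_right (s₁ := φ.support) (s₂ := ψ.support)),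
    ← Finset.sum_add_distrib]
  exact Finset.sum_le_sum fun y _ => norm_add_le _ _

theorem oneNorm_sum_le {ι : Type*} (t : Finset ι) (φ : ι → Y →₀ V) :
    oneNorm (∑ i ∈ t, φ i) ≤ ∑ i ∈ t, oneNorm (φ i) :=
  Finset.le_sum_of_subadditive _ oneNorm_zero.le oneNorm_add_le t φ

theorem oneNorm_smul [NormedSpace ℂ V] (c : ℂ) (φ : Y →₀ V) :
    oneNorm (c • φ) = ‖c‖ * oneNorm φ := by
  rw [oneNorm_eq_sum (Finsupp.support_smul (b := c) (g := φ)), oneNorm_eq_sum subset_rfl,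
    Finset.mul_sum]
  exact Finset.sum_congr rfl fun y _ => norm_smul _ _

theorem oneNorm_map_le [NormedSpace ℂ V] {D : (Y →₀ V) →ₗ[ℂ] (Y →₀ V)} {C : ℝ}
    (hD : ∀ y v, oneNorm (D (Finsupp.single y v)) ≤ C * ‖v‖) (φ : Y →₀ V) :
    oneNorm (D φ) ≤ C * oneNorm φ := by
  conv_lhs => rw [← Finsupp.sum_single φ, Finsupp.sum, map_sum]
  refine (oneNorm_sum_le _ _).trans ?_
  rw [oneNorm, Finsupp.sum, Finset.mul_sum]
  exact Finset.sum_le_sum fun y _ => hD y _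

theorem oneNorm_pow_map_le [NormedSpace ℂ V] {D : (Y →₀ V) →ₗ[ℂ] (Y →₀ V)} {C : ℝ}
    (hC : 0 ≤ C) (hD : ∀ y v, oneNorm (D (Finsupp.single y v)) ≤ C * ‖v‖) (n : ℕ)
    (φ : Y →₀ V) : oneNorm ((D ^ n) φ) ≤ C ^ n * oneNorm φ := by
  induction n with
  | zero => simp
  | succ n ih =>
    rw [pow_succ', Module.End.mul_apply, pow_succ', mul_assoc]
    exact (oneNorm_map_le hD _).trans (mul_le_mul_of_nonneg_left ih hC)

end OneNorm

section Equivariance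

variable [Group Γ] [MulAction Γ Y] [NormedAddCommGroup V] [InnerProductSpace ℂ V]

theorem secAct_single (ρ : Γ →* (V ≃ₗᵢ[ℂ] V)) (γ : Γ) (y : Y) (v : V) :
    secAct ρ γ (Finsupp.single y v) = Finsupp.single (γ • y) (ρ γ v) := by
  simp [secAct, Finsupp.mapRange_single, Finsupp.equivMapDomain_single]

theorem oneNorm_secAct (ρ : Γ →* (V ≃ₗᵢ[ℂ] V)) (γ : Γ) (φ : Y →₀ V) :
    oneNorm (secAct ρ γ φ) = oneNorm φ := by
  rw [secAct, oneNorm, Finsupp.sum_equivMapDomain, Finsupp.sum_mapRange_index fun _ => norm_zero]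
  simp [oneNorm]

theorem rep_mul_apply (ρ : Γ →* (V ≃ₗᵢ[ℂ] V)) (g h : Γ) (v : V) :
    ρ (g * h) v = ρ g (ρ h v) := by
  rw [map_mul]
  rfl

theorem rep_mul_inv_apply (ρ : Γ →* (V ≃ₗᵢ[ℂ] V)) (γ : Γ) (v : V) : ρ γ (ρ γ⁻¹ v) = v := by
  rw [← rep_mul_apply, mul_inv_cancel, map_one]
  rfl

theorem IsEquivariantOp.pow {ρ : Γ →* (V ≃ₗᵢ[ℂ] V)} {D : (Y →₀ V) →ₗ[ℂ] (Y →₀ V)}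
    (hD : IsEquivariantOp ρ D) (n : ℕ) : IsEquivariantOp ρ (D ^ n) := by
  induction n with
  | zero => intro γ φ; rfl
  | succ n ih => intro γ φ; rw [pow_succ, Module.End.mul_apply, hD, ih, Module.End.mul_apply]

theorem IsPushdown.pow {ρ : Γ →* (V ≃ₗᵢ[ℂ] V)} {Γ' : Subgroup Γ}
    {D : (Y →₀ V) →ₗ[ℂ] (Y →₀ V)}
    {DG : equivSubmodule (Y := Y) ρ Γ' →ₗ[ℂ] equivSubmodule (Y := Y) ρ Γ'}
    (h : IsPushdown ρ Γ' D DG) (n : ℕ) : IsPushdown ρ Γ' (D ^ n) (DG ^ n) := by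
  induction n with
  | zero => intro w φ hw; exact hw
  | succ n ih =>
    intro w φ hw
    rw [pow_succ, pow_succ, Module.End.mul_apply, Module.End.mul_apply]
    exact ih _ _ (h w φ hw)

/-- An invariant operator is bounded for the `ℓ¹`-norm if there are finitely many orbits. -/
theorem IsEquivariantOp.exists_oneNorm_bound [FiniteDimensional ℂ V]
    {ρ : Γ →* (V ≃ₗᵢ[ℂ] V)} {D : (Y →₀ V) →ₗ[ℂ] (Y →₀ V)} (hD : IsEquivariantOp ρ D)
    {S : Set Y} [Fintype S] (hS : ∀ y : Y, ∃ s : S, ∃ g : Γ, g • (s : Y) = y) :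
    ∃ C : ℝ, 0 ≤ C ∧ ∀ y v, oneNorm (D (Finsupp.single y v)) ≤ C * ‖v‖ := by
  let e := stdOrthonormalBasis ℂ V
  refine ⟨∑ s : S, ∑ k, oneNorm (D (Finsupp.single (s : Y) (e k))),
    Finset.sum_nonneg fun _ _ => Finset.sum_nonneg fun _ _ => oneNorm_nonneg _, fun y v => ?_⟩
  obtain ⟨s, g, rfl⟩ := hS y
  have h1 : ∀ w : V, oneNorm (D (Finsupp.single (s : Y) w)) ≤
      (∑ k, oneNorm (D (Finsupp.single (s : Y) (e k)))) * ‖w‖ := by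
    intro w
    have hw : Finsupp.single (s : Y) w =
        ∑ k, inner ℂ (e k) w • Finsupp.single (s : Y) (e k) := by
      conv_lhs => rw [← e.sum_repr' w]
      rw [← Finsupp.lsingle_apply (R := ℂ), map_sum]
      simp only [map_smul, Finsupp.lsingle_apply]
    rw [hw, map_sum, Finset.sum_mul]
    refine (oneNorm_sum_le _ _).trans (Finset.sum_le_sum fun k _ => ?_)
    rw [map_smul, oneNorm_smul, mul_comm]
    refine mul_le_mul_of_nonneg_left ?_ (oneNorm_nonneg _)
    simpa using norm_inner_le_norm (𝕜 := ℂ) (e k) w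
  rw [← rep_mul_inv_apply ρ g v, ← secAct_single, hD, oneNorm_secAct]
  refine (h1 _).trans ?_
  simp only [LinearIsometryEquiv.norm_map]
  refine mul_le_mul_of_nonneg_right (Finset.single_le_sum
    (f := fun s : S => ∑ k, oneNorm (D (Finsupp.single (s : Y) (e k))))
    (fun _ _ => Finset.sum_nonneg fun _ _ => oneNorm_nonneg _) (Finset.mem_univ s)) (norm_nonneg v)

end Equivariance

section Summation

variable [Group Γ] [MulAction Γ Y] [NormedAddCommGroup V] [InnerProductSpace ℂ V]

theorem smul_left_injective_of_free (hfree : ∀ (γ : Γ) (y : Y), γ • y = y → γ = 1) (y : Y) :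
    Function.Injective fun γ : Γ => γ • y := by
  intro a b hab
  have : (b⁻¹ * a) • y = y := by
    rw [mul_smul, show a • y = b • y from hab, inv_smul_smul]
  exact (inv_mul_eq_one.mp (hfree _ _ this)).symm

theorem finite_support_smap (hfree : ∀ (γ : Γ) (y : Y), γ • y = y → γ = 1)
    (ρ : Γ →* (V ≃ₗᵢ[ℂ] V)) (Γ' : Subgroup Γ) (φ : Y →₀ V) (y : Y) :
    (Function.support fun γ : Γ' => ρ ((γ : Γ)⁻¹) (φ ((γ : Γ) • y))).Finite := by
  have hinj : Function.Injective fun γ : Γ' => (γ : Γ) • y :=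
    (smul_left_injective_of_free hfree y).comp Subtype.val_injective
  refine (φ.support.finite_toSet.preimage hinj.injOn).subset fun γ hγ => ?_
  simp only [Set.mem_preimage, Finset.mem_coe, Finsupp.mem_support_iff]
  intro h
  exact hγ (by simp [h])

theorem smap_mem (ρ : Γ →* (V ≃ₗᵢ[ℂ] V)) (Γ' : Subgroup Γ) (φ : Y →₀ V)
    (hfree : ∀ (γ : Γ) (y : Y), γ • y = y → γ = 1) :
    smap ρ Γ' φ ∈ equivSubmodule (Y := Y) ρ Γ' := by
  intro γ y
  have h := (ρ (γ : Γ)).toLinearEquiv.toAddEquiv.toAddMonoidHom.map_finsum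
    (finite_support_smap hfree ρ Γ' φ y)
  change smap ρ Γ' φ _ = ρ (γ : Γ) (∑ᶠ γ : Γ', ρ ((γ : Γ)⁻¹) (φ ((γ : Γ) • y)))
  refine Eq.trans ?_ h.symm
  refine finsum_eq_of_bijective (fun δ : Γ' => δ * γ) (Group.mulRight_bijective γ) fun δ => ?_
  change _ = ρ (γ : Γ) (ρ ((δ * γ : Γ') : Γ)⁻¹ (φ (((δ * γ : Γ') : Γ) • y)))
  rw [← rep_mul_apply, smul_smul]
  simp

/-- The summation map as a linear map. -/
def smapLinear (hfree : ∀ (γ : Γ) (y : Y), γ • y = y → γ = 1)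
    (ρ : Γ →* (V ≃ₗᵢ[ℂ] V)) (Γ' : Subgroup Γ) :
    (Y →₀ V) →ₗ[ℂ] equivSubmodule (Y := Y) ρ Γ' where
  toFun φ := ⟨smap ρ Γ' φ, smap_mem ρ Γ' φ hfree⟩
  map_add' φ ψ := by
    ext y
    simp only [Submodule.coe_add, Pi.add_apply, smap, Finsupp.add_apply, map_add]
    exact finsum_add_distrib (finite_support_smap hfree ρ Γ' φ y)
      (finite_support_smap hfree ρ Γ' ψ y)
  map_smul' c φ := by
    ext y
    simp only [Submodule.coe_smul, Pi.smul_apply, smap, Finsupp.smul_apply, map_smul,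
      RingHom.id_apply]
    exact (smul_finsum' c (finite_support_smap hfree ρ Γ' φ y)).symm

theorem norm_smap_le (hfree : ∀ (γ : Γ) (y : Y), γ • y = y → γ = 1)
    (ρ : Γ →* (V ≃ₗᵢ[ℂ] V)) (Γ' : Subgroup Γ) (φ : Y →₀ V) (y : Y) :
    ‖smap ρ Γ' φ y‖ ≤ oneNorm φ := by
  classical
  rw [smap, finsum_eq_sum _ (finite_support_smap hfree ρ Γ' φ y)]
  refine (norm_sum_le _ _).trans ?_
  simp only [LinearIsometryEquiv.norm_map]
  rw [← Finset.sum_image (f := fun x => ‖φ x‖) (g := fun γ : Γ' => (γ : Γ) • y)]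
  · exact sum_norm_le_oneNorm φ _
  · exact ((smul_left_injective_of_free hfree y).comp Subtype.val_injective).injOn

theorem smap_eq_of_forall (ρ : Γ →* (V ≃ₗᵢ[ℂ] V)) (Γ' : Subgroup Γ) (φ : Y →₀ V) (y : Y)
    (h : ∀ γ ∈ Γ', γ ≠ 1 → φ (γ • y) = 0) : smap ρ Γ' φ y = φ y := by
  rw [smap, finsum_eq_single _ (1 : Γ')]
  · simp
  · intro γ hγ
    rw [h γ γ.2 (by simpa using hγ), map_zero]

/-- Along a tower of subgroups, the summation map is eventually evaluation. -/
theorem eventually_smap_eq (hfree : ∀ (γ : Γ) (y : Y), γ • y = y → γ = 1)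
    (ρ : Γ →* (V ≃ₗᵢ[ℂ] V)) {Γs : ℕ → Subgroup Γ} (hanti : Antitone Γs)
    (hinter : (⨅ j, Γs j) = ⊥) (φ : Y →₀ V) (y : Y) :
    ∀ᶠ j in atTop, smap ρ (Γs j) φ y = φ y := by
  have hfin : {γ : Γ | γ • y ∈ φ.support}.Finite :=
    φ.support.finite_toSet.preimage (smul_left_injective_of_free hfree y).injOn
  have h : ∀ γ ∈ {γ : Γ | γ • y ∈ φ.support}, ∀ᶠ j in atTop, γ ∈ Γs j → γ = 1 := by
    intro γ _
    by_cases hγ : γ = 1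
    · exact Eventually.of_forall fun _ _ => hγ
    · have : γ ∉ ⨅ j, Γs j := by rwa [hinter, Subgroup.mem_bot]
      simp only [Subgroup.mem_iInf, not_forall] at this
      obtain ⟨j₀, hj₀⟩ := this
      filter_upwards [eventually_ge_atTop j₀] with j hj hmem
      exact absurd (hanti hj hmem) hj₀
  filter_upwards [(eventually_all_finite hfin).mpr h] with j hj
  refine smap_eq_of_forall ρ _ φ y fun γ hγ hne => ?_
  by_contra h0
  exact hne (hj γ (Finsupp.mem_support_iff.mpr h0) hγ)

theorem smap_secAct (hfree : ∀ (γ : Γ) (y : Y), γ • y = y → γ = 1)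
    (ρ : Γ →* (V ≃ₗᵢ[ℂ] V)) (Γ' : Subgroup Γ) [Γ'.Normal] (φ : Y →₀ V) (g : Γ) (y : Y) :
    smap ρ Γ' (secAct ρ g φ) (g • y) = ρ g (smap ρ Γ' φ y) := by
  have h := (ρ g).toLinearEquiv.toAddEquiv.toAddMonoidHom.map_finsum
    (finite_support_smap hfree ρ Γ' φ y)
  change _ = ρ g (∑ᶠ γ : Γ', ρ ((γ : Γ)⁻¹) (φ ((γ : Γ) • y)))
  refine Eq.trans ?_ h.symm
  refine finsum_eq_of_bijective (MulAut.conjNormal (H := Γ') g⁻¹)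
    (MulEquiv.bijective _) fun δ => ?_
  change ρ (δ : Γ)⁻¹ (ρ g (φ (g⁻¹ • (δ : Γ) • g • y))) =
    ρ g (ρ ((MulAut.conjNormal (H := Γ') g⁻¹ δ : Γ') : Γ)⁻¹
      (φ (((MulAut.conjNormal (H := Γ') g⁻¹ δ : Γ') : Γ) • y)))
  rw [← rep_mul_apply, ← rep_mul_apply,
    smul_smul, smul_smul, MulAut.conjNormal_apply]
  simp [mul_assoc]

end Summation

section Trace

variable [Group Γ] [MulAction Γ Y] [NormedAddCommGroup V] [InnerProductSpace ℂ V]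

/-- The diagonal block at `y` of the pushdown of `A` to `W_{Γ'}`, that is
`v ↦ (S_{Γ'} A δ_{y,v})(y)`. -/
def diagBlock (hfree : ∀ (γ : Γ) (y : Y), γ • y = y → γ = 1)
    (ρ : Γ →* (V ≃ₗᵢ[ℂ] V)) (Γ' : Subgroup Γ) (A : (Y →₀ V) →ₗ[ℂ] (Y →₀ V)) (y : Y) :
    V →ₗ[ℂ] V :=
  LinearMap.proj y ∘ₗ (equivSubmodule (Y := Y) ρ Γ').subtype ∘ₗ smapLinear hfree ρ Γ' ∘ₗ A ∘ₗ
    Finsupp.lsingle y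

theorem diagBlock_apply (hfree : ∀ (γ : Γ) (y : Y), γ • y = y → γ = 1)
    (ρ : Γ →* (V ≃ₗᵢ[ℂ] V)) (Γ' : Subgroup Γ) (A : (Y →₀ V) →ₗ[ℂ] (Y →₀ V)) (y : Y) (v : V) :
    diagBlock hfree ρ Γ' A y v = smap ρ Γ' (A (Finsupp.single y v)) y := rfl

theorem trace_diagBlock_smul (hfree : ∀ (γ : Γ) (y : Y), γ • y = y → γ = 1)
    (ρ : Γ →* (V ≃ₗᵢ[ℂ] V)) (Γ' : Subgroup Γ) [Γ'.Normal] {A : (Y →₀ V) →ₗ[ℂ] (Y →₀ V)}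
    (hA : IsEquivariantOp ρ A) (g : Γ) (y : Y) :
    LinearMap.trace ℂ V (diagBlock hfree ρ Γ' A (g • y)) =
      LinearMap.trace ℂ V (diagBlock hfree ρ Γ' A y) := by
  rw [← LinearMap.trace_conj' (diagBlock hfree ρ Γ' A y) (ρ g).toLinearEquiv]
  congr 1
  ext v
  obtain ⟨w, rfl⟩ := (ρ g).surjective v
  rw [LinearEquiv.conj_apply_apply, diagBlock_apply, ← secAct_single, hA, smap_secAct hfree]
  have : (ρ g).toLinearEquiv.symm (ρ g w) = w := (ρ g).symm_apply_apply w
  rw [this]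
  rfl

theorem norm_trace_le [FiniteDimensional ℂ V] (L : V →ₗ[ℂ] V) {c : ℝ}
    (hL : ∀ v, ‖L v‖ ≤ c * ‖v‖) :
    ‖LinearMap.trace ℂ V L‖ ≤ Module.finrank ℂ V * c := by
  let e := stdOrthonormalBasis ℂ V
  rw [LinearMap.trace_eq_sum_inner L e]
  refine (norm_sum_le _ _).trans ?_
  refine (Finset.sum_le_card_nsmul _ _ c fun k _ => ?_).trans (by simp)
  refine (norm_inner_le_norm _ _).trans ?_
  simpa using hL (e k)

theorem eventually_trace_diagBlock_eq [FiniteDimensional ℂ V]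
    (hfree : ∀ (γ : Γ) (y : Y), γ • y = y → γ = 1)
    (ρ : Γ →* (V ≃ₗᵢ[ℂ] V)) {Γs : ℕ → Subgroup Γ} (hanti : Antitone Γs)
    (hinter : (⨅ j, Γs j) = ⊥) (A : (Y →₀ V) →ₗ[ℂ] (Y →₀ V)) (y : Y) :
    ∀ᶠ j in atTop, LinearMap.trace ℂ V (diagBlock hfree ρ (Γs j) A y) =
      LinearMap.trace ℂ V (kernelOf A y y) := by
  let e := stdOrthonormalBasis ℂ V
  have h : ∀ᶠ j in atTop, ∀ k, smap ρ (Γs j) (A (Finsupp.single y (e k))) y =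
      A (Finsupp.single y (e k)) y :=
    eventually_all.mpr fun k => eventually_smap_eq hfree ρ hanti hinter _ y
  filter_upwards [h] with j hj
  rw [LinearMap.trace_eq_sum_inner _ e, LinearMap.trace_eq_sum_inner _ e]
  refine Finset.sum_congr rfl fun k _ => ?_
  rw [diagBlock_apply, hj]
  rfl

/-- The trace of a pushdown is the sum of the traces of its diagonal blocks over a family of
representatives of the orbits. -/
theorem IsPushdown.trace_eq_sum [FiniteDimensional ℂ V]
    (hfree : ∀ (γ : Γ) (y : Y), γ • y = y → γ = 1)
    {ρ : Γ →* (V ≃ₗᵢ[ℂ] V)} {Γ' : Subgroup Γ} {A : (Y →₀ V) →ₗ[ℂ] (Y →₀ V)}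
    {T : equivSubmodule (Y := Y) ρ Γ' →ₗ[ℂ] equivSubmodule (Y := Y) ρ Γ'}
    (hT : IsPushdown ρ Γ' A T) {ι : Type*} [Fintype ι] (r : ι → Y)
    (hsurj : ∀ y, ∃ γ ∈ Γ', ∃ i, γ • r i = y)
    (hinj : ∀ γ ∈ Γ', ∀ i k, γ • r i = r k → i = k) :
    LinearMap.trace ℂ _ T = ∑ i, LinearMap.trace ℂ V (diagBlock hfree ρ Γ' A (r i)) := by
  classical
  let e := stdOrthonormalBasis ℂ V
  have hδ : ∀ i k v, smap ρ Γ' (Finsupp.single (r i) v) (r k) = (Pi.single i v : ι → V) k := by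
    intro i k v
    by_cases hik : i = k
    · subst hik
      rw [smap_eq_of_forall]
      · simp
      · intro γ _ hne
        exact Finsupp.single_eq_of_ne fun h => hne (hfree _ _ h)
    · rw [Pi.single_eq_of_ne (Ne.symm hik), smap]
      refine finsum_eq_zero_of_forall_eq_zero fun γ => ?_
      rw [Finsupp.single_eq_of_ne fun h => hik (hinj γ γ.2 k i h).symm, map_zero]
  let E : equivSubmodule (Y := Y) ρ Γ' →ₗ[ℂ] (ι → V) :=
    LinearMap.funLeft ℂ V r ∘ₗ (equivSubmodule (Y := Y) ρ Γ').subtype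
  have hE : ∀ f i, E f i = (f : Y → V) (r i) := fun _ _ => rfl
  have hEinj : Function.Injective E := by
    intro f f' h
    ext y
    obtain ⟨γ, hγ, i, rfl⟩ := hsurj y
    rw [f.2 ⟨γ, hγ⟩ (r i), f'.2 ⟨γ, hγ⟩ (r i), ← hE, ← hE, h]
  have hEδ : ∀ i v, E (smapLinear hfree ρ Γ' (Finsupp.single (r i) v)) = Pi.single i v :=
    fun i v => funext fun k => hδ i k v
  have hEsurj : Function.Surjective E := by
    intro u
    refine ⟨∑ i, smapLinear hfree ρ Γ' (Finsupp.single (r i) (u i)), ?_⟩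
    rw [map_sum]
    simp only [hEδ]
    exact Finset.univ_sum_single u
  let E' := LinearEquiv.ofBijective E ⟨hEinj, hEsurj⟩
  let b := (Pi.basis fun _ : ι => e.toBasis).map E'.symm
  have hb : ∀ p, b p = smapLinear hfree ρ Γ' (Finsupp.single (r p.1) (e p.2)) := by
    intro p
    rw [Module.Basis.map_apply, LinearEquiv.symm_apply_eq, Pi.basis_apply,
      OrthonormalBasis.coe_toBasis]
    exact (hEδ _ _).symm
  rw [LinearMap.trace_eq_matrix_trace ℂ b, Matrix.trace, Fintype.sum_sigma]
  refine Finset.sum_congr rfl fun i _ => ?_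
  rw [LinearMap.trace_eq_sum_inner _ e]
  refine Finset.sum_congr rfl fun k _ => ?_
  rw [Matrix.diag_apply, LinearMap.toMatrix_apply, hb]
  have h1 : b.repr (T (smapLinear hfree ρ Γ' (Finsupp.single (r i) (e k)))) ⟨i, k⟩ =
      e.toBasis.repr (E (T (smapLinear hfree ρ Γ' (Finsupp.single (r i) (e k)))) i) k := rfl
  rw [h1, OrthonormalBasis.coe_toBasis_repr_apply, OrthonormalBasis.repr_apply_apply, hE,
    hT _ _ rfl, diagBlock_apply]

/-- The normalized trace of a pushdown to a normal subgroup of finite index. -/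
theorem IsPushdown.trace_eq_index_mul [FiniteDimensional ℂ V]
    (hfree : ∀ (γ : Γ) (y : Y), γ • y = y → γ = 1)
    {ρ : Γ →* (V ≃ₗᵢ[ℂ] V)} {Γ' : Subgroup Γ} [Γ'.Normal] [Γ'.FiniteIndex]
    {A : (Y →₀ V) →ₗ[ℂ] (Y →₀ V)} (hA : IsEquivariantOp ρ A)
    {T : equivSubmodule (Y := Y) ρ Γ' →ₗ[ℂ] equivSubmodule (Y := Y) ρ Γ'}
    (hT : IsPushdown ρ Γ' A T) {S : Set Y} [Fintype S] (hS : IsRepSet Γ S) :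
    LinearMap.trace ℂ _ T =
      Γ'.index * ∑ s : S, LinearMap.trace ℂ V (diagBlock hfree ρ Γ' A s) := by
  classical
  have : Fintype (Γ ⧸ Γ') := Fintype.ofFinite _
  rw [hT.trace_eq_sum hfree (fun p : (Γ ⧸ Γ') × S => p.1.out • (p.2 : Y))]
  · simp only [trace_diagBlock_smul hfree ρ Γ' hA, Fintype.sum_prod_type, Finset.sum_const,
      Finset.card_univ, nsmul_eq_mul]
    rw [Subgroup.index, Nat.card_eq_fintype_card]
  · intro y
    obtain ⟨s, ⟨hs, hsy⟩, -⟩ := hS y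
    obtain ⟨g, rfl⟩ := MulAction.mem_orbit_symm.mp hsy
    refine ⟨g * ((g : Γ ⧸ Γ').out)⁻¹, ?_, ((g : Γ ⧸ Γ'), ⟨s, hs⟩), ?_⟩
    · rw [← QuotientGroup.eq_one_iff]
      simp
    · simp [smul_smul]
  · rintro γ hγ ⟨c, s⟩ ⟨c', s'⟩ h
    simp only at h
    have hss : s = s' := by
      obtain ⟨t, -, ht⟩ := hS (c'.out • (s' : Y))
      refine Subtype.ext ((ht s ⟨s.2, ?_⟩).trans (ht s' ⟨s'.2, ?_⟩).symm)
      · rw [← h, smul_smul]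
        exact MulAction.mem_orbit_symm.mp ⟨_, rfl⟩
      · exact MulAction.mem_orbit_symm.mp ⟨_, rfl⟩
    subst hss
    rw [smul_smul] at h
    have hc := smul_left_injective_of_free hfree (s : Y) h
    have hcc : ((γ * c.out : Γ) : Γ ⧸ Γ') = ((c'.out : Γ) : Γ ⧸ Γ') := congrArg _ hc
    rw [QuotientGroup.mk_mul, (QuotientGroup.eq_one_iff γ).mpr hγ, one_mul,
      QuotientGroup.out_eq', QuotientGroup.out_eq'] at hcc
    rw [hcc]

end Trace

section HeatKernel

variable [NormedAddCommGroup V] [InnerProductSpace ℂ V] 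
theorem norm_kernelOf_pow_apply_le {D : (Y →₀ V) →ₗ[ℂ] (Y →₀ V)} {C : ℝ} (hC : 0 ≤ C)
    (hD : ∀ y v, oneNorm (D (Finsupp.single y v)) ≤ C * ‖v‖) (n : ℕ) (x y : Y) (v : V) :
    ‖kernelOf (D ^ n) x y v‖ ≤ C ^ n * ‖v‖ := by
  refine (norm_apply_le_oneNorm _ x).trans ?_
  simpa using oneNorm_pow_map_le hC hD n (Finsupp.single y v)

variable [FiniteDimensional ℂ V]

theorem summable_heatKer {D : (Y →₀ V) →ₗ[ℂ] (Y →₀ V)} {C : ℝ} (hC : 0 ≤ C)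
    (hD : ∀ y v, oneNorm (D (Finsupp.single y v)) ≤ C * ‖v‖) (z : ℂ) (x y : Y) :
    Summable fun n : ℕ => (z ^ n / (n.factorial : ℂ)) • kernelOfL (D ^ n) x y := by
  refine Summable.of_norm_bounded (Real.summable_pow_div_factorial (‖z‖ * C)) fun n => ?_
  rw [norm_smul, norm_div, norm_pow, Complex.norm_natCast, mul_pow, mul_div_right_comm]
  gcongr
  exact ContinuousLinearMap.opNorm_le_bound _ (pow_nonneg hC n)
    (norm_kernelOf_pow_apply_le hC hD n x y)

theorem hasSum_trace_heatKer {D : (Y →₀ V) →ₗ[ℂ] (Y →₀ V)} {C : ℝ} (hC : 0 ≤ C)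
    (hD : ∀ y v, oneNorm (D (Finsupp.single y v)) ≤ C * ‖v‖) (z : ℂ) (x y : Y) :
    HasSum (fun n : ℕ => z ^ n / (n.factorial : ℂ) * LinearMap.trace ℂ V (kernelOf (D ^ n) x y))
      (LinearMap.trace ℂ V ((heatKer D z x y : V →L[ℂ] V) : V →ₗ[ℂ] V)) := by
  let τ : (V →L[ℂ] V) →L[ℂ] ℂ :=
    LinearMap.toContinuousLinearMap (LinearMap.trace ℂ V ∘ₗ ContinuousLinearMap.coeLM ℂ)
  have h := τ.hasSum (summable_heatKer hC hD z x y).hasSum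
  simp only [map_smul, smul_eq_mul] at h
  exact h

theorem trGammaHeat_eq_tsum {D : (Y →₀ V) →ₗ[ℂ] (Y →₀ V)} {C : ℝ}
    (hC : 0 ≤ C) (hD : ∀ y v, oneNorm (D (Finsupp.single y v)) ≤ C * ‖v‖) (z : ℂ) (S : Set Y)
    [Fintype S] :
    trGammaHeat D z S = ∑' n : ℕ, z ^ n / (n.factorial : ℂ) *
      ∑ s : S, LinearMap.trace ℂ V (kernelOf (D ^ n) s s) := by
  rw [trGammaHeat, ← finsum_set_coe_eq_finsum_mem, finsum_eq_sum_of_fintype]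
  simp only [Finset.mul_sum]
  exact (hasSum_sum fun (s : S) _ => hasSum_trace_heatKer hC hD z (s : Y) s).tsum_eq.symm

end HeatKernel

theorem IsRepSet.finite [Group Γ] [MulAction Γ Y] {S : Set Y} (hS : IsRepSet Γ S)
    [Finite (MulAction.orbitRel.Quotient Γ Y)] : Finite S := by
  refine Finite.of_injective
    (fun s : S => (Quotient.mk'' (s : Y) : MulAction.orbitRel.Quotient Γ Y)) fun s s' h => ?_
  obtain ⟨t, -, ht⟩ := hS s'
  have h' : (s : Y) ∈ MulAction.orbit Γ (s' : Y) := Quotient.exact h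
  exact Subtype.ext ((ht s ⟨s.2, h'⟩).trans (ht s' ⟨s'.2, MulAction.mem_orbit_self _⟩).symm)

/-- Let `D` be `Γ`-invariant of finite propagation speed and `(Γ_j)` a tower in
`Γ`.  Then `tr e^{zD_{Γ_j}}/[Γ:Γ_j] → tr_Γ e^{zD}` as `j → ∞`, uniformly for `z`
in the closed unit disc. -/
theorem heat_trace_uniform_convergence
    [MetricSpace Y] [Group Γ] [MulAction Γ Y]
    [NormedAddCommGroup V] [InnerProductSpace ℂ V] [FiniteDimensional ℂ V]
    (hball : ∀ (y : Y) (R : ℝ), (Metric.closedBall y R).Finite)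
    (hiso : ∀ γ : Γ, Isometry (fun y : Y => γ • y))
    (hfree : ∀ (γ : Γ) (y : Y), γ • y = y → γ = 1)
    (horb : Finite (MulAction.orbitRel.Quotient Γ Y))
    (ρ : Γ →* (V ≃ₗᵢ[ℂ] V))
    (D : (Y →₀ V) →ₗ[ℂ] (Y →₀ V))
    (hinv : IsEquivariantOp ρ D)
    (hprop : ∃ R : ℝ, HasPropSpeed D R)
    (Γs : ℕ → Subgroup Γ) (htop : Γs 0 = ⊤)
    (hdec : ∀ j, Γs (j + 1) ≤ Γs j)
    (hnorm : ∀ j, (Γs j).Normal) (hfi : ∀ j, (Γs j).FiniteIndex)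
    (hinter : (⨅ j, Γs j) = ⊥)
    (DG : ∀ j, equivSubmodule (Y := Y) ρ (Γs j) →ₗ[ℂ] equivSubmodule (Y := Y) ρ (Γs j))
    (hDG : ∀ j, IsPushdown ρ (Γs j) D (DG j))
    (S : Set Y) (hS : IsRepSet Γ S) :
    TendstoUniformlyOn (fun (j : ℕ) (z : ℂ) => trExp (DG j) z / ((Γs j).index : ℂ))
      (fun z => trGammaHeat D z S) atTop (Metric.closedBall 0 1) := by
  have hSfin : Finite S := hS.finite
  have : Fintype S := Fintype.ofFinite S
  have hrep : ∀ y : Y, ∃ s : S, ∃ g : Γ, g • (s : Y) = y := by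
    intro y
    obtain ⟨s, ⟨hs, hsy⟩, -⟩ := hS y
    exact ⟨⟨s, hs⟩, MulAction.mem_orbit_symm.mp hsy⟩
  obtain ⟨C, hC, hD⟩ := hinv.exists_oneNorm_bound hrep
  let a : ℕ → ℕ → ℂ := fun j n =>
    ∑ s : S, LinearMap.trace ℂ V (diagBlock hfree ρ (Γs j) (D ^ n) s)
  have ha : ∀ j n, ‖a j n‖ ≤ (Fintype.card S * Module.finrank ℂ V : ℝ) * C ^ n := by
    intro j n
    refine (norm_sum_le _ _).trans ?_
    refine (Finset.sum_le_card_nsmul _ _ (Module.finrank ℂ V * C ^ n) fun s _ => ?_).trans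
      (by simp [mul_assoc])
    refine norm_trace_le _ fun v => (norm_smap_le hfree ρ _ _ _).trans ?_
    simpa using oneNorm_pow_map_le hC hD n (Finsupp.single (s : Y) v)
  have hlim : ∀ n, Tendsto (fun j => a j n) atTop
      (nhds (∑ s : S, LinearMap.trace ℂ V (kernelOf (D ^ n) s s))) := fun n =>
    tendsto_finsetSum _ fun s _ => tendsto_nhds_of_eventually_eq
      (eventually_trace_diagBlock_eq hfree ρ (antitone_nat_of_succ_le hdec) hinter (D ^ n) s)
  have hmain := tendstoUniformlyOn_expSeries a _ _ C ha hlim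
  simp only [← trGammaHeat_eq_tsum hC hD] at hmain
  refine hmain.congr (Eventually.of_forall fun j z _ => ?_)
  have := hnorm j
  have := hfi j
  have hindex : ((Γs j).index : ℂ) ≠ 0 := Nat.cast_ne_zero.mpr Subgroup.FiniteIndex.index_ne_zero
  simp only [trExp]
  rw [← tsum_div_const]
  refine tsum_congr fun n => ?_
  rw [((hDG j).pow n).trace_eq_index_mul hfree (hinv.pow n) hS]
  field_simp
  rfl
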